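/- arXiv:2103.08874 — 9 statements merged into one kernel-verified Lean document; each statement's English description precedes it below -/
import Mathlib

section
/- Let n ≥ 2, p ≥ 1, N ≥ 1 and let x : Fin n → Fin p → Fin N → ℝ be a multivariate functional sample satisfying assumption (a). Then for every i ∈ Fin n, MBD(u, i) ≤ g_n(1 − MEI(v, i)), where u and v are the dimension-wise MEI and MBD matrices of x and where the outer MBD and MEI are computed treating the rows of u and v as curves indexed by Fin p. -/
open Finset

/-- Modified epigraph index of the `i`-th curve in a sample of `m` curves
observed at `M` points. -/
noncomputable def MEI {m M : ℕ} (y : Fin m → Fin M → ℝ) (i : Fin m) : ℝ :=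
  (1 / ((m : ℝ) * (M : ℝ))) *
    ∑ h : Fin m, ((univ.filter (fun k : Fin M => y h k ≥ y i k)).card : ℝ)

/-- Modified band depth of the `i`-th curve in a sample of `m` curves
observed at `M` points. -/
noncomputable def MBD {m M : ℕ} (y : Fin m → Fin M → ℝ) (i : Fin m) : ℝ :=
  (1 / ((m.choose 2 : ℝ) * (M : ℝ))) *
    ∑ h : Fin m, ∑ l : Fin m,
      if h < l then
        ((univ.filter (fun k : Fin M =>
          min (y h k) (y l k) ≤ y i k ∧ y i k ≤ max (y h k) (y l k))).card : ℝ)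
      else 0

/-- The parabola `g_n(z) = 2/n + z − n·z²/(2(n−1))`. -/
noncomputable def gpar (n : ℕ) (z : ℝ) : ℝ :=
  2 / (n : ℝ) + z - (n : ℝ) * z ^ 2 / (2 * ((n : ℝ) - 1))

/-- The parabola `f_n(z) = a0 + a1·z + a2·n²·z²` with
`a0 = a2 = −2/(n(n−1))` and `a1 = 2(n+1)/(n−1)`. -/
noncomputable def fpar (n : ℕ) (z : ℝ) : ℝ :=
  (-2 / ((n : ℝ) * ((n : ℝ) - 1))) + (2 * ((n : ℝ) + 1) / ((n : ℝ) - 1)) * z +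
    (-2 / ((n : ℝ) * ((n : ℝ) - 1))) * (n : ℝ) ^ 2 * z ^ 2

/-- number of sample values strictly below the `i`-th one -/
noncomputable def lowc {n : ℕ} (a : Fin n → ℝ) (i : Fin n) : ℕ :=
  (univ.filter (fun h => a h < a i)).card

noncomputable def dep (n L : ℕ) : ℝ :=
  2 / ((n : ℝ) * (n - 1)) * ((L : ℝ) * (n - 1 - L) + (n - 1))

noncomputable def MBD1 {n : ℕ} (a : Fin n → ℝ) (i : Fin n) : ℝ :=
  (1 / (n.choose 2 : ℝ)) * ∑ h : Fin n, ∑ l : Fin n,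
    if h < l then (if min (a h) (a l) ≤ a i ∧ a i ≤ max (a h) (a l) then (1 : ℝ) else 0) else 0

noncomputable def MEI1 {n : ℕ} (a : Fin n → ℝ) (i : Fin n) : ℝ :=
  (1 / (n : ℝ)) * ∑ h : Fin n, if a h ≥ a i then (1 : ℝ) else 0

lemma MEI_eq {m M : ℕ} (y : Fin m → Fin M → ℝ) (i : Fin m) :
    MEI y i = (1 / (M : ℝ)) * ∑ k, MEI1 (fun h => y h k) i := by
  unfold MEI MEI1
  rw [← Finset.mul_sum, Finset.sum_comm, ← mul_assoc]
  congr 1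
  · rw [one_div_mul_one_div, mul_comm]
  · refine Finset.sum_congr rfl fun h _ => ?_
    simp

lemma MBD_eq {m M : ℕ} (y : Fin m → Fin M → ℝ) (i : Fin m) :
    MBD y i = (1 / (M : ℝ)) * ∑ k, MBD1 (fun h => y h k) i := by
  unfold MBD MBD1
  rw [← Finset.mul_sum, ← mul_assoc]
  congr 1
  · rw [one_div_mul_one_div, mul_comm]
  · symm
    rw [Finset.sum_comm]
    refine Finset.sum_congr rfl fun h _ => ?_
    rw [Finset.sum_comm]
    refine Finset.sum_congr rfl fun l _ => ?_
    split_ifs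
    · simp
    · simp

lemma low_up {n : ℕ} (a : Fin n → ℝ) (ha : Function.Injective a) (i : Fin n) :
    lowc a i + (univ.filter (fun h => a i < a h)).card + 1 = n := by
  have h1 := Finset.card_filter_add_card_filter_not (s := (univ : Finset (Fin n)))
    (fun h => a h < a i)
  have h2 : univ.filter (fun h => ¬ a h < a i) = insert i (univ.filter (fun h => a i < a h)) := by
    ext h
    simp only [mem_filter, mem_univ, true_and, mem_insert, not_lt, le_iff_lt_or_eq]
    constructor
    · rintro (h | h)
      · exact Or.inr h
      · exact Or.inl (ha h.symm)
    · rintro (h | h)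
      · exact Or.inr (by rw [h])
      · exact Or.inl h
  rw [h2, Finset.card_insert_of_notMem (by simp)] at h1
  simp only [Finset.card_univ, Fintype.card_fin] at h1
  unfold lowc
  omega

lemma lowc_lt {n : ℕ} (a : Fin n → ℝ) (h i : Fin n) : lowc a h < lowc a i ↔ a h < a i := by
  have key : ∀ s t : Fin n, a s ≤ a t → lowc a s ≤ lowc a t := fun s t hst =>
    Finset.card_le_card fun w hw => by
      simp only [mem_filter, mem_univ, true_and] at hw ⊢
      exact lt_of_lt_of_le hw hst
  constructor
  · intro hl
    by_contra hc
    exact absurd (key _ _ (not_lt.mp hc)) (by omega)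
  · intro hl
    apply Finset.card_lt_card
    rw [Finset.ssubset_iff_of_subset]
    · exact ⟨h, by simpa using hl, by simp⟩
    · intro w hw
      simp only [mem_filter, mem_univ, true_and] at hw ⊢
      exact hw.trans hl

lemma MEI1_eq {n : ℕ} (hn : 2 ≤ n) (a : Fin n → ℝ) (i : Fin n) :
    MEI1 a i = 1 - (lowc a i : ℝ) / n := by
  have hn0 : (n : ℝ) ≠ 0 := by positivity
  have h1 := Finset.card_filter_add_card_filter_not (s := (univ : Finset (Fin n)))
    (fun h => a h < a i)
  simp only [Finset.card_univ, Fintype.card_fin, not_lt] at h1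
  have h2 : (lowc a i : ℝ) + ((univ.filter (fun h => a i ≤ a h)).card : ℝ) = n := by
    exact_mod_cast h1
  unfold MEI1
  simp only [ge_iff_le, Finset.sum_boole]
  field_simp
  linarith

lemma MBD1_eq {n : ℕ} (hn : 2 ≤ n) (a : Fin n → ℝ) (ha : Function.Injective a) (i : Fin n) :
    MBD1 a i = dep n (lowc a i) := by
  set F : Fin n → Fin n → ℝ := fun h l =>
    if min (a h) (a l) ≤ a i ∧ a i ≤ max (a h) (a l) then (1 : ℝ) else 0 with hF
  have hsym : ∀ h l, F h l = F l h := fun h l => by simp only [hF, min_comm, max_comm]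
  set S : ℝ := ∑ h : Fin n, ∑ l : Fin n, if h < l then F h l else 0 with hS
  have h2 : 2 * S = ∑ h : Fin n, ∑ l : Fin n, if h = l then 0 else F h l := by
    have hS' : S = ∑ h : Fin n, ∑ l : Fin n, if l < h then F h l else 0 := by
      rw [hS, Finset.sum_comm]
      refine Finset.sum_congr rfl fun h _ => Finset.sum_congr rfl fun l _ => ?_
      rw [hsym]
    rw [two_mul]
    nth_rewrite 1 [hS]
    rw [hS', ← Finset.sum_add_distrib]
    refine Finset.sum_congr rfl fun h _ => ?_
    rw [← Finset.sum_add_distrib]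
    refine Finset.sum_congr rfl fun l _ => ?_
    rcases lt_trichotomy h l with hl | hl | hl
    · simp [hl, hl.ne, hl.not_gt]
    · simp [hl]
    · simp [hl, hl.ne', hl.not_gt]
  set e : Fin n → ℝ := fun h => if a h < a i then 1 else 0 with he
  set f : Fin n → ℝ := fun h => if a i < a h then 1 else 0 with hf
  set c : Fin n → ℝ := fun h => if h = i then 1 else 0 with hc
  have hpt : ∀ h l, (if h = l then 0 else F h l) =
      e h * f l + f h * e l + c h + c l - (if h = l then 2 * c h else 0) := by
    intro h l
    have hh : h = i ↔ a h = a i := ha.eq_iff.symm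
    have hl : l = i ↔ a l = a i := ha.eq_iff.symm
    by_cases hhl : h = l
    · subst hhl
      simp only [he, hf, hc, if_true]
      split_ifs <;> grind
    · have hal : a h ≠ a l := fun q => hhl (ha q)
      simp only [he, hf, hc, hF, if_neg hhl, hh, hl, min_le_iff, le_max_iff]
      clear_value F S
      clear h2 hS hsym
      split_ifs <;> first | (norm_num; done) | (exfalso; grind)
  have hse : ∑ h, e h = (lowc a i : ℝ) := by simp [he, lowc]
  have hsf : ∑ h, f h = (n : ℝ) - 1 - lowc a i := by
    have := low_up a ha i
    have h3 : (lowc a i : ℝ) + ((univ.filter (fun h => a i < a h)).card : ℝ) + 1 = n := by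
      exact_mod_cast this
    simp only [hf, Finset.sum_boole]
    linarith
  have hsc : ∑ h, c h = 1 := by simp [hc]
  have h3 : 2 * S = 2 * ((lowc a i : ℝ) * (n - 1 - lowc a i) + (n - 1)) := by
    rw [h2]
    simp only [hpt, Finset.sum_add_distrib, Finset.sum_sub_distrib, ← Finset.mul_sum,
      ← Finset.sum_mul, Finset.sum_ite_eq, mem_univ, if_true, hse, hsf, hsc, Finset.sum_const,
      Finset.card_univ, Fintype.card_fin, nsmul_eq_mul]
    ring
  have hn2 : (2 : ℝ) ≤ n := by exact_mod_cast hn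
  have hn0 : (n : ℝ) ≠ 0 := by positivity
  have hn1 : (n : ℝ) - 1 ≠ 0 := by linarith
  change (1 / (n.choose 2 : ℝ)) * S = _
  unfold dep
  rw [show S = (lowc a i : ℝ) * (n - 1 - lowc a i) + (n - 1) by linarith, Nat.cast_choose_two]
  field_simp

lemma dep_lt {n : ℕ} (hn : 2 ≤ n) (s t : ℕ) :
    dep n s < dep n t ↔ (s : ℝ) * (n - 1 - s) < (t : ℝ) * (n - 1 - t) := by
  have hn2 : (2 : ℝ) ≤ n := by exact_mod_cast hn
  have : 0 < 2 / ((n : ℝ) * (n - 1)) := by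
    apply div_pos two_pos (mul_pos _ _) <;> linarith
  unfold dep
  rw [mul_lt_mul_iff_right₀ this, add_lt_add_iff_right]

lemma count_dep {n : ℕ} (hn : 2 ≤ n) (t : ℕ) (ht : t < n) :
    ((range n).filter (fun s => dep n s < dep n t)).card = 2 * min t (n - 1 - t) := by
  set m := min t (n - 1 - t) with hm
  have hE : (range n).filter (fun s => dep n s < dep n t) = range m ∪ Ico (n - m) n := by
    ext s
    simp only [mem_filter, mem_range, mem_union, mem_Ico, dep_lt hn]
    obtain ⟨t', rfl⟩ : ∃ t', n = t + t' + 1 := ⟨n - 1 - t, by omega⟩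
    have hm' : m = min t t' := by rw [hm]; congr 1; omega
    constructor
    · rintro ⟨hs, h⟩
      push_cast at h
      have h' : ((t : ℝ) - s) * (t' - s) > 0 := by nlinarith
      rcases lt_or_ge s m with q | q
      · exact Or.inl q
      · right
        refine ⟨?_, hs⟩
        by_contra hc
        rcases le_total t t' with w | w
        · have w1 : t ≤ s := by omega
          have w2 : s ≤ t' := by omega
          have w1' : (t : ℝ) ≤ s := by exact_mod_cast w1
          have w2' : (s : ℝ) ≤ t' := by exact_mod_cast w2
          nlinarith
        · have w1 : t' ≤ s := by omega
          have w2 : s ≤ t := by omega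
          have w1' : (t' : ℝ) ≤ s := by exact_mod_cast w1
          have w2' : (s : ℝ) ≤ t := by exact_mod_cast w2
          nlinarith
    · intro h
      have hs : s < t + t' + 1 := by omega
      refine ⟨hs, ?_⟩
      push_cast
      have h' : (s < t ∧ s < t') ∨ (t < s ∧ t' < s) := by omega
      rcases h' with ⟨w1, w2⟩ | ⟨w1, w2⟩
      · have w1' : (s : ℝ) < t := by exact_mod_cast w1
        have w2' : (s : ℝ) < t' := by exact_mod_cast w2
        nlinarith [mul_pos (sub_pos.2 w1') (sub_pos.2 w2')]
      · have w1' : (t : ℝ) < s := by exact_mod_cast w1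
        have w2' : (t' : ℝ) < s := by exact_mod_cast w2
        nlinarith [mul_pos (sub_pos.2 w1') (sub_pos.2 w2')]
  rw [hE, Finset.card_union_of_disjoint, Finset.card_range, Nat.card_Ico]
  · omega
  · rw [Finset.disjoint_left]
    intro s
    simp only [mem_range, mem_Ico]
    omega

lemma lowc_lt_n {n : ℕ} (a : Fin n → ℝ) (ha : Function.Injective a) (i : Fin n) :
    lowc a i < n := by
  have := low_up a ha i
  omega

lemma lowc_dep {n : ℕ} (hn : 2 ≤ n) (a : Fin n → ℝ) (ha : Function.Injective a) (i : Fin n) :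
    lowc (fun h => dep n (lowc a h)) i = 2 * min (lowc a i) (n - 1 - lowc a i) := by
  rw [← count_dep hn _ (lowc_lt_n a ha i)]
  have hinj : Function.Injective (lowc a) := by
    intro s t hst
    apply ha
    have h1 := lowc_lt a s t
    have h2 := lowc_lt a t s
    have h3 : ¬ a s < a t := fun q => by have := h1.2 q; omega
    have h4 : ¬ a t < a s := fun q => by have := h2.2 q; omega
    exact le_antisymm (not_lt.1 h4) (not_lt.1 h3)
  have himg : univ.image (lowc a) = range n := by
    apply Finset.eq_of_subset_of_card_le
    · intro s hs
      simp only [mem_image, mem_univ, true_and] at hs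
      obtain ⟨h, rfl⟩ := hs
      exact mem_range.2 (lowc_lt_n a ha h)
    · rw [Finset.card_image_of_injective _ hinj]
      simp
  rw [← himg, Finset.filter_image, Finset.card_image_of_injective _ hinj]
  rfl

lemma dep_gpar {n : ℕ} (hn : 2 ≤ n) (t : ℕ) (ht : t < n) :
    dep n t = gpar n (((2 * min t (n - 1 - t) : ℕ) : ℝ) / n) := by
  obtain ⟨t', rfl⟩ : ∃ t', n = t + t' + 1 := ⟨n - 1 - t, by omega⟩
  have hn2 : (2 : ℝ) ≤ ((t + t' + 1 : ℕ) : ℝ) := by exact_mod_cast hn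
  have hn0 : ((t + t' + 1 : ℕ) : ℝ) ≠ 0 := by linarith
  have hn1 : ((t + t' + 1 : ℕ) : ℝ) - 1 ≠ 0 := by linarith
  have e : t + t' + 1 - 1 - t = t' := by omega
  rw [e]
  unfold dep gpar
  have hmul : ∀ m : ℕ, ((m : ℝ) - t) * (m - t') = 0 →
      2 / (((t + t' + 1 : ℕ) : ℝ) * (((t + t' + 1 : ℕ) : ℝ) - 1)) *
        ((t : ℝ) * (((t + t' + 1 : ℕ) : ℝ) - 1 - t) + (((t + t' + 1 : ℕ) : ℝ) - 1)) =
      2 / ((t + t' + 1 : ℕ) : ℝ) + ((2 * m : ℕ) : ℝ) / ((t + t' + 1 : ℕ) : ℝ) -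
      ((t + t' + 1 : ℕ) : ℝ) * (((2 * m : ℕ) : ℝ) / ((t + t' + 1 : ℕ) : ℝ)) ^ 2 /
        (2 * (((t + t' + 1 : ℕ) : ℝ) - 1)) := by
    intro m hm
    have hr : ((t + t' + 1 : ℕ) : ℝ) = t + t' + 1 := by push_cast; ring
    generalize ((t + t' + 1 : ℕ) : ℝ) = r at *
    have ht' : (t' : ℝ) = r - 1 - t := by linarith
    rw [ht'] at hm
    push_cast
    field_simp
    linear_combination hm
  apply hmul
  rcases le_total t t' with w | w
  · rw [min_eq_left w]; ring
  · rw [min_eq_right w]; ring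

lemma gpar_jensen {n p : ℕ} (hn : 2 ≤ n) (hp : 1 ≤ p) (z : Fin p → ℝ) :
    (1 / (p : ℝ)) * ∑ j, gpar n (z j) ≤ gpar n ((1 / (p : ℝ)) * ∑ j, z j) := by
  have hn2 : (2 : ℝ) ≤ n := by exact_mod_cast hn
  have hp0 : (0 : ℝ) < p := by exact_mod_cast hp
  have hsq := sq_sum_le_card_mul_sum_sq (s := (univ : Finset (Fin p))) (f := z)
  simp only [Finset.card_univ, Fintype.card_fin] at hsq
  have hs : ∑ j, gpar n (z j) = p * (2 / (n : ℝ)) + ∑ j, z j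
      - (n : ℝ) / (2 * ((n : ℝ) - 1)) * ∑ j, z j ^ 2 := by
    rw [Finset.mul_sum]
    unfold gpar
    rw [Finset.sum_sub_distrib, Finset.sum_add_distrib]
    congr 1
    · simp
    · refine Finset.sum_congr rfl fun j _ => ?_
      ring
  rw [hs]
  unfold gpar
  have hk : 0 ≤ (n : ℝ) / (2 * ((n : ℝ) - 1)) := by
    apply div_nonneg <;> linarith
  set K := (n : ℝ) / (2 * ((n : ℝ) - 1)) with hK
  have h1 : (n : ℝ) * (1 / (p : ℝ) * ∑ j, z j) ^ 2 / (2 * ((n : ℝ) - 1)) =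
      K * ((1 / (p : ℝ)) * ∑ j, z j) ^ 2 := by rw [hK]; ring
  rw [h1]
  have h2 : ((1 / (p : ℝ)) * ∑ j, z j) ^ 2 ≤ (1 / (p : ℝ)) * ∑ j, z j ^ 2 := by
    rw [mul_pow, div_pow, one_pow, div_mul_eq_mul_div, div_mul_eq_mul_div, one_mul, one_mul,
      div_le_div_iff₀ (by positivity) hp0]
    nlinarith
  have h3 := mul_le_mul_of_nonneg_left h2 hk
  have h4 : (1 / (p : ℝ)) * (p * (2 / (n : ℝ))) = 2 / n := by field_simp
  rw [mul_sub, mul_add, h4]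
  linarith

theorem depthgram_prop1_inequality (n p N : ℕ) (hn : 2 ≤ n) (hp : 1 ≤ p) (hN : 1 ≤ N)
    (x : Fin n → Fin p → Fin N → ℝ)
    (ha : ∀ j : Fin p, ∀ i h : Fin n, i ≠ h → ∀ k1 k2 : Fin N,
      (x i j k1 - x h j k1) * (x i j k2 - x h j k2) > 0) :
    ∀ i : Fin n,
      MBD (fun i' j => MEI (fun h => x h j) i') i ≤
        gpar n (1 - MEI (fun i' j => MBD (fun h => x h j) i') i) := by

  intro i
  have hN0 : (N : ℝ) ≠ 0 := by
    have : N ≠ 0 := by omega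
    exact_mod_cast this
  have hp0 : (p : ℝ) ≠ 0 := by
    have : p ≠ 0 := by omega
    exact_mod_cast this
  have hn0 : (n : ℝ) ≠ 0 := by
    have : n ≠ 0 := by omega
    exact_mod_cast this
  let k0 : Fin N := ⟨0, hN⟩
  have hinj : ∀ j k, Function.Injective (fun h => x h j k) := by
    intro j k s t hst
    by_contra hne
    have := ha j s t hne k k
    simp only at hst
    rw [hst] at this
    simp at this
  have hlow : ∀ j k s, lowc (fun h => x h j k) s = lowc (fun h => x h j k0) s := by
    intro j k s
    unfold lowc
    congr 1
    ext h
    simp only [mem_filter, mem_univ, true_and]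
    by_cases hs : h = s
    · subst hs; simp
    · have := ha j h s hs k k0
      rcases pos_and_pos_or_neg_and_neg_of_mul_pos this with ⟨q, r⟩ | ⟨q, r⟩
      · exact ⟨fun _ => by linarith, fun _ => by linarith⟩
      · exact ⟨fun _ => by linarith, fun _ => by linarith⟩
  have hu : ∀ s j, MEI (fun h => x h j) s = 1 - (lowc (fun h => x h j k0) s : ℝ) / n := by
    intro s j
    rw [MEI_eq]
    simp only [MEI1_eq hn, hlow, Finset.sum_const, Finset.card_univ, Fintype.card_fin, nsmul_eq_mul]
    field_simp
  have hv : ∀ s j, MBD (fun h => x h j) s = dep n (lowc (fun h => x h j k0) s) := by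
    intro s j
    rw [MBD_eq]
    have : ∀ k, MBD1 (fun h => x h j k) s = dep n (lowc (fun h => x h j k0) s) := fun k => by
      rw [MBD1_eq hn _ (hinj j k), hlow]
    simp only [this, Finset.sum_const, Finset.card_univ, Fintype.card_fin, nsmul_eq_mul]
    field_simp
  simp only [hu, hv]
  rw [MBD_eq, MEI_eq]
  have hpos : (0 : ℝ) < n := by positivity
  have hcol : ∀ j, MBD1 (fun h => 1 - (lowc (fun h => x h j k0) h : ℝ) / n) i
      = dep n (lowc (fun h => x h j k0) i) := by
    intro j
    have hlt : ∀ s t, 1 - (lowc (fun h => x h j k0) s : ℝ) / n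
        < 1 - (lowc (fun h => x h j k0) t : ℝ) / n ↔ x t j k0 < x s j k0 := by
      intro s t
      rw [sub_lt_sub_iff_left, div_lt_div_iff_of_pos_right hpos, Nat.cast_lt, lowc_lt]
    rw [MBD1_eq hn]
    · have h1 := low_up _ (hinj j k0) i
      have h2 : lowc (fun h => 1 - (lowc (fun h => x h j k0) h : ℝ) / n) i
          = (univ.filter (fun h => x i j k0 < x h j k0)).card := by
        unfold lowc
        congr 1
        ext h
        simp only [mem_filter, mem_univ, true_and]
        exact hlt h i
      rw [h2]
      have h3 : (lowc (fun h => x h j k0) i : ℝ)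
          + ((univ.filter (fun h => x i j k0 < x h j k0)).card : ℝ) + 1 = n := by
        exact_mod_cast h1
      unfold dep
      rw [← h3]
      ring
    · intro s t hst
      apply hinj j k0
      have h1 := hlt s t
      have h2 := hlt t s
      simp only at hst ⊢
      rw [hst] at h1 h2
      simp only [lt_self_iff_false, false_iff, not_lt] at h1 h2
      exact le_antisymm h1 h2
  simp only [hcol, MEI1_eq hn, lowc_dep hn _ (hinj _ k0)]
  have hz : 1 - 1 / (p : ℝ) * ∑ j : Fin p, (1 - ((2 * min (lowc (fun h => x h j k0) i)
      (n - 1 - lowc (fun h => x h j k0) i) : ℕ) : ℝ) / n) =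
      1 / (p : ℝ) * ∑ j : Fin p, ((2 * min (lowc (fun h => x h j k0) i)
      (n - 1 - lowc (fun h => x h j k0) i) : ℕ) : ℝ) / n := by
    rw [Finset.sum_sub_distrib]
    simp only [Finset.sum_const, Finset.card_univ, Fintype.card_fin, nsmul_eq_mul, mul_one, mul_sub]
    rw [one_div_mul_cancel hp0]
    ring
  rw [hz]
  refine le_trans (le_of_eq ?_) (gpar_jensen hn hp _)
  congr 1
  exact Finset.sum_congr rfl fun j _ => dep_gpar hn _ (lowc_lt_n _ (hinj j k0) i)
end

section
/- Let n ≥ 2, p ≥ 1, N ≥ 1 and let x : Fin n → Fin p → Fin N → ℝ be a multivariate functional sample satisfying both assumption (a) and assumption (b). Then for every i ∈ Fin n, MBD(u, i) = g_n(1 − MEI(v, i)), where u and v are the dimension-wise MEI and MBD matrices of x and where the outer MBD and MEI are computed treating the rows of u and v as curves indexed by Fin p. -/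
open Finset

lemma aux_card {M : ℕ} (P : Prop) [Decidable P] (Q : Fin M → Prop) [DecidablePred Q]
    (h : ∀ k, Q k ↔ P) : ((univ.filter Q).card : ℝ) = if P then (M : ℝ) else 0 := by
  by_cases hP : P
  · simp [hP, h]
  · simp [hP, h]

lemma aux_pairs {n : ℕ} (F : Fin n → Fin n → ℝ) (hF : ∀ h l, F h l = F l h) :
    2 * (∑ h, ∑ l, if h < l then F h l else 0) = (∑ h, ∑ l, F h l) - ∑ h, F h h := by
  have h1 : (∑ h, ∑ l, F h l) = (∑ h, ∑ l, if h < l then F h l else 0)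
      + (∑ h, ∑ l, if l < h then F h l else 0) + ∑ h, F h h := by
    have : ∀ h, F h h = ∑ l, if h = l then F h l else 0 := by intro h; simp
    rw [Finset.sum_congr rfl (fun h _ => this h), ← sum_add_distrib, ← sum_add_distrib]
    refine sum_congr rfl fun h _ => ?_
    rw [← sum_add_distrib, ← sum_add_distrib]
    refine sum_congr rfl fun l _ => ?_
    rcases lt_trichotomy h l with c | c | c
    · simp [c, c.ne, c.not_gt]
    · simp [c]
    · simp [c, c.ne', c.not_gt]
  have h2 : (∑ h, ∑ l, if l < h then F h l else 0) = (∑ h, ∑ l, if h < l then F h l else 0) := by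
    rw [sum_comm]
    refine sum_congr rfl fun h _ => sum_congr rfl fun l _ => ?_
    rw [hF]
  rw [h1, h2]; ring

lemma aux_MBD {n M : ℕ} (hM : 1 ≤ M) (y : Fin n → Fin M → ℝ)
    (e : Equiv.Perm (Fin n)) (he : ∀ h i k, y h k ≤ y i k ↔ e h ≤ e i) (i : Fin n) :
    MBD y i = (1 / (n.choose 2 : ℝ)) * ((e i : ℝ) * ((n : ℝ) - 1 - e i) + (n - 1)) := by
  have hM' : (M : ℝ) ≠ 0 := by positivity
  set A : Fin n → ℝ := fun h => if e h < e i then 1 else 0 with hA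
  set B : Fin n → ℝ := fun h => if e i < e h then 1 else 0 with hB
  have key : ∀ h l, ((univ.filter (fun k : Fin M =>
          min (y h k) (y l k) ≤ y i k ∧ y i k ≤ max (y h k) (y l k))).card : ℝ)
          = M * (1 - A h * A l - B h * B l) := by
    intro h l
    rw [aux_card ((e h ≤ e i ∨ e l ≤ e i) ∧ (e i ≤ e h ∨ e i ≤ e l))]
    · simp only [hA, hB]
      rcases lt_trichotomy (e h) (e i) with c | c | c <;>
      rcases lt_trichotomy (e l) (e i) with d | d | d <;>
      simp [c, d, c.le, d.le, c.not_gt, d.not_gt, ← not_lt]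
    · intro k
      simp only [min_le_iff, le_max_iff, he]
  have sA : ∑ h, A h = (e i : ℝ) := by
    have : ∑ h, A h = ∑ h, (if h < e i then (1:ℝ) else 0) :=
      Equiv.sum_comp e (fun h => if h < e i then (1:ℝ) else 0)
    rw [this, sum_boole]
    congr 1
    rw [Finset.filter_gt_eq_Iio]; simp
  have sB : ∑ h, B h = (n : ℝ) - 1 - (e i : ℝ) := by
    have : ∑ h, B h = ∑ h, (if e i < h then (1:ℝ) else 0) :=
      Equiv.sum_comp e (fun h => if e i < h then (1:ℝ) else 0)
    rw [this, sum_boole, Finset.filter_lt_eq_Ioi, Fin.card_Ioi]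
    have := (e i).2
    rw [Nat.sub_sub, Nat.cast_sub (by omega)]; push_cast; ring
  have sD : ∑ h, (1 - A h * A h - B h * B h) = 1 := by
    have : ∀ h, (1 - A h * A h - B h * B h) = if h = i then 1 else 0 := by
      intro h
      simp only [hA, hB]
      rcases lt_trichotomy (e h) (e i) with c | c | c
      · have : h ≠ i := by rintro rfl; exact lt_irrefl _ c
        simp [c, c.not_gt, this]
      · have : h = i := e.injective c
        simp [this]
      · have : h ≠ i := by rintro rfl; exact lt_irrefl _ c
        simp [c, c.not_gt, this]
    simp [this]
  have sF : ∑ h, ∑ l, (1 - A h * A l - B h * B l) =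
      (n : ℝ) ^ 2 - (e i : ℝ) ^ 2 - ((n : ℝ) - 1 - (e i : ℝ)) ^ 2 := by
    simp only [sum_sub_distrib, ← mul_sum, ← sum_mul, sA, sB]
    simp; ring
  have hp := aux_pairs (fun h l => (1 - A h * A l - B h * B l)) (by intro h l; ring)
  rw [sD, sF] at hp
  have hs : (∑ h : Fin n, ∑ l : Fin n, if h < l then
        ((univ.filter (fun k : Fin M =>
          min (y h k) (y l k) ≤ y i k ∧ y i k ≤ max (y h k) (y l k))).card : ℝ)
      else 0) = M * ∑ h : Fin n, ∑ l : Fin n, if h < l then (1 - A h * A l - B h * B l) else 0 := by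
    simp only [mul_sum, key, mul_ite, mul_zero]
  unfold MBD
  rw [hs]
  have h3 : (∑ h : Fin n, ∑ l : Fin n, if h < l then (1 - A h * A l - B h * B l) else 0)
    = ((e i : ℝ) * ((n : ℝ) - 1 - e i) + (n - 1)) := by linarith
  rw [h3]
  rw [one_div, one_div, mul_inv, mul_assoc, ← mul_assoc (M : ℝ)⁻¹, inv_mul_cancel₀ hM', one_mul]

lemma aux_MEI {n M : ℕ} (hM : 1 ≤ M) (y : Fin n → Fin M → ℝ) (i : Fin n)
    (e : Equiv.Perm (Fin n)) (P : Fin n → Prop) [DecidablePred P]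
    (he : ∀ h k, y i k ≤ y h k ↔ P (e h)) :
    MEI y i = ((univ.filter P).card : ℝ) / n := by
  have hM' : (M : ℝ) ≠ 0 := by positivity
  have key : ∀ h, ((univ.filter (fun k : Fin M => y h k ≥ y i k)).card : ℝ) =
      if P (e h) then (M : ℝ) else 0 := fun h => aux_card _ _ (he h)
  unfold MEI
  simp only [key]
  rw [Equiv.sum_comp e (fun h => if P h then (M : ℝ) else 0), ← sum_filter, sum_const, nsmul_eq_mul]
  have hn : (n : ℝ) ≠ 0 := by have := i.pos; positivity
  field_simp

lemma aux_count {n : ℕ} (b : Fin n) :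
    ((univ.filter (fun a : Fin n => (b : ℝ) * ((n : ℝ) - 1 - b) ≤ (a : ℝ) * ((n : ℝ) - 1 - a))).card : ℝ)
      = n - 2 * min (b : ℝ) ((n : ℝ) - 1 - b) := by
  have hb := b.2
  have hb1 : (b : ℝ) + 1 ≤ n := by exact_mod_cast hb
  have iff : ∀ a : Fin n, (b : ℝ) * ((n : ℝ) - 1 - b) ≤ (a : ℝ) * ((n : ℝ) - 1 - a) ↔
     ((b : ℕ) ≤ a ∧ (a : ℕ) + b + 1 ≤ n) ∨ ((a : ℕ) ≤ b ∧ n ≤ (a : ℕ) + b + 1) := by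
    intro a
    have e1 : (b : ℝ) * ((n : ℝ) - 1 - b) ≤ (a : ℝ) * ((n : ℝ) - 1 - a) ↔
      0 ≤ ((a : ℝ) - b) * ((n : ℝ) - (a + b + 1)) := by
      rw [← sub_nonneg]; ring_nf
    rw [e1, mul_nonneg_iff]
    simp only [sub_nonneg, sub_nonpos]
    norm_cast
  simp only [iff]
  rcases le_total (2 * (b : ℕ) + 1) n with c | c
  · have c' : 2 * (b : ℝ) + 1 ≤ n := by exact_mod_cast c
    rw [min_eq_left (by linarith)]
    have : (univ.filter (fun a : Fin n => ((b : ℕ) ≤ a ∧ (a : ℕ) + b + 1 ≤ n) ∨ ((a : ℕ) ≤ b ∧ n ≤ (a : ℕ) + b + 1)))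
      = Finset.Icc b ⟨n - 1 - b, by omega⟩ := by
      ext a
      simp only [mem_filter, mem_univ, true_and, mem_Icc, Fin.le_def]
      have := a.2
      omega
    rw [this, Fin.card_Icc]
    have : n - 1 - (b : ℕ) + 1 - b = n - 2 * b := by omega
    simp only [this]
    rw [Nat.cast_sub (by omega)]; push_cast; ring
  · have c' : (n : ℝ) ≤ 2 * (b : ℝ) + 1 := by exact_mod_cast c
    rw [min_eq_right (by linarith)]
    have : (univ.filter (fun a : Fin n => ((b : ℕ) ≤ a ∧ (a : ℕ) + b + 1 ≤ n) ∨ ((a : ℕ) ≤ b ∧ n ≤ (a : ℕ) + b + 1)))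
      = Finset.Icc ⟨n - 1 - b, by omega⟩ b := by
      ext a
      simp only [mem_filter, mem_univ, true_and, mem_Icc, Fin.le_def]
      have := a.2
      omega
    rw [this, Fin.card_Icc]
    have : (b : ℕ) + 1 - (n - 1 - b) = 2 * b + 2 - n := by omega
    simp only [this]
    rw [Nat.cast_sub (by omega)]; push_cast; ring

lemma aux_perm {n : ℕ} (w : Fin n → ℝ) (hw : Function.Injective w) :
    ∃ e : Equiv.Perm (Fin n), ∀ h i, w h ≤ w i ↔ e h ≤ e i := by
  have hlt : ∀ i, (univ.filter (fun h => w h < w i)).card < n := by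
    intro i
    have : (univ.filter (fun h => w h < w i)).card < (univ : Finset (Fin n)).card := by
      apply card_lt_card
      rw [Finset.ssubset_univ_iff]
      intro h
      have : i ∈ (univ.filter (fun h => w h < w i)) := by rw [h]; simp
      simp at this
    simpa using this
  let r : Fin n → Fin n := fun i => ⟨_, hlt i⟩
  have hr : ∀ h i, w h < w i → r h < r i := by
    intro h i hh
    simp only [r, Fin.lt_def]
    apply card_lt_card
    rw [Finset.ssubset_iff_of_subset]
    · exact ⟨h, by simpa using hh, by simp⟩
    · intro l; simp only [mem_filter, mem_univ, true_and]; intro hl; exact hl.trans hh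
  have hinj : Function.Injective r := by
    intro a b hab
    by_contra hne
    rcases lt_or_gt_of_ne (hw.ne hne) with c | c
    · exact absurd hab (hr _ _ c).ne
    · exact absurd hab (hr _ _ c).ne'
  refine ⟨Equiv.ofBijective r (Finite.injective_iff_bijective.mp hinj), fun h i => ?_⟩
  simp only [Equiv.ofBijective_apply]
  constructor
  · intro hle
    rcases hle.lt_or_eq with c | c
    · exact (hr _ _ c).le
    · rw [hw c]
  · intro hle
    by_contra hc
    exact absurd (hr _ _ (not_le.mp hc)) (not_lt.mpr hle)

theorem depthgram_prop1_equality (n p N : ℕ) (hn : 2 ≤ n) (hp : 1 ≤ p) (hN : 1 ≤ N)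
    (x : Fin n → Fin p → Fin N → ℝ)
    (ha : ∀ j : Fin p, ∀ i h : Fin n, i ≠ h → ∀ k1 k2 : Fin N,
      (x i j k1 - x h j k1) * (x i j k2 - x h j k2) > 0)
    (hb : ∀ k : Fin N, ∀ i h : Fin n, i ≠ h → ∀ j l : Fin p, j ≠ l →
      (x i j k - x h j k) * (x i l k - x h l k) > 0) :
    ∀ i : Fin n,
      MBD (fun i' j => MEI (fun h => x h j) i') i =
        gpar n (1 - MEI (fun i' j => MBD (fun h => x h j) i') i) := by
  intro i
  have hpn : (p : ℝ) ≠ 0 := by positivity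
  let j0 : Fin p := ⟨0, hp⟩
  let k0 : Fin N := ⟨0, hN⟩
  have hw : Function.Injective (fun i => x i j0 k0) := by
    intro a b hab
    by_contra hne
    have := ha j0 a b hne k0 k0
    simp only at hab
    rw [hab] at this; simp at this
  obtain ⟨e, he0⟩ := aux_perm _ hw
  have sgn : ∀ a b : ℝ, a * b > 0 → (a ≤ 0 ↔ b ≤ 0) := by
    intro a b hab
    constructor
    · intro h; by_contra hc; nlinarith [not_le.mp hc]
    · intro h; by_contra hc; nlinarith [not_le.mp hc]
  have he : ∀ j h i k, x h j k ≤ x i j k ↔ e h ≤ e i := by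
    intro j h i k
    rw [← he0]
    by_cases hne : h = i
    · subst hne; simp
    have h1 := sgn _ _ (ha j h i hne k k0)
    simp only [sub_nonpos] at h1
    rw [h1]
    by_cases hj : j = j0
    · rw [hj]
    have h2 := sgn _ _ (hb k0 h i hne j j0 hj)
    simpa only [sub_nonpos] using h2
  have hn0 : (n : ℝ) ≠ 0 := by positivity
  have hn2 : (2 : ℝ) ≤ n := by exact_mod_cast hn
  have hnpos : (0 : ℝ) < n := by linarith
  have hu : ∀ i' j, MEI (fun h => x h j) i' = ((n : ℝ) - e i') / n := by
    intro i' j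
    rw [aux_MEI hN (fun h => x h j) i' e (fun a => e i' ≤ a) (fun h k => he j i' h k)]
    rw [Finset.filter_le_eq_Ici, Fin.card_Ici, Nat.cast_sub (e i').2.le]
  have hv : ∀ i' j, MBD (fun h => x h j) i' = (1 / (n.choose 2 : ℝ)) * ((e i' : ℝ) * ((n : ℝ) - 1 - e i') + (n - 1)) :=
    fun i' j => aux_MBD hN (fun h => x h j) e (fun h i k => he j h i k) i'
  simp only [hu, hv]
  have hc : (n.choose 2 : ℝ) = n * (n - 1) / 2 := Nat.cast_choose_two ℝ n
  have hc0 : (0 : ℝ) < 1 / (n.choose 2 : ℝ) := by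
    rw [hc]; apply one_div_pos.mpr; apply div_pos _ two_pos; apply mul_pos <;> linarith
  rw [aux_MBD hp _ (e.trans Fin.revPerm) (by
    intro h i k
    simp only [Equiv.trans_apply, Fin.revPerm_apply, Fin.rev_le_rev]
    rw [div_le_div_iff_of_pos_right hnpos, sub_le_sub_iff_left, Nat.cast_le, Fin.le_def])]
  rw [aux_MEI hp _ i e (fun a : Fin n => (e i : ℝ) * ((n : ℝ) - 1 - e i) ≤ (a : ℝ) * ((n : ℝ) - 1 - a)) (by
    intro h k
    rw [mul_le_mul_iff_right₀ hc0, add_le_add_iff_right])]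
  rw [aux_count]
  have hrev : ((Fin.rev (e i) : Fin n) : ℝ) = (n : ℝ) - 1 - e i := by
    rw [Fin.val_rev, Nat.cast_sub (e i).2]; push_cast; ring
  simp only [Equiv.trans_apply, Fin.revPerm_apply, hrev]
  rw [hc]
  unfold gpar
  have hn1 : (n : ℝ) - 1 ≠ 0 := by intro h; linarith
  rcases le_total (e i : ℝ) ((n : ℝ) - 1 - e i) with c | c
  · rw [min_eq_left c]; field_simp; ring
  · rw [min_eq_right c]; field_simp; ring
end

section
/- Let n ≥ 2, p ≥ 1, N ≥ 1 and let x : Fin n → Fin p → Fin N → ℝ be a multivariate functional sample satisfying both assumption (a) and assumption (b). Then for every i ∈ Fin n, MBD(ut, i) = g_n(1 − MEI(vt, i)), where ut and vt are the time-wise MEI and MBD matrices of x and where the outer MBD and MEI are computed treating the rows of ut and vt as curves indexed by Fin N. -/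
open Finset

lemma MEI_of_iff {m M : ℕ} (hM : 1 ≤ M) (y : Fin m → Fin M → ℝ) (i : Fin m)
    (P : Fin m → Prop) [DecidablePred P] (h : ∀ l k, y l k ≥ y i k ↔ P l) :
    MEI y i = ((univ.filter P).card : ℝ) / m := by
  unfold MEI
  have hM' : (M : ℝ) ≠ 0 := by positivity
  have : ∀ l : Fin m, ((univ.filter (fun k : Fin M => y l k ≥ y i k)).card : ℝ)
      = M * (if P l then (1 : ℝ) else 0) := by
    intro l
    by_cases hl : P l <;> simp only [h, hl] <;> simp
  simp only [this, ← Finset.mul_sum]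
  rw [Finset.sum_boole]
  by_cases hm : (m : ℝ) = 0
  · simp [hm]
  · field_simp

lemma card_perm {m : ℕ} (σ : Equiv.Perm (Fin m)) (P : Fin m → Prop) [DecidablePred P] :
    (univ.filter (fun l => P (σ l))).card = (univ.filter P).card := by
  rw [← Finset.card_map σ.toEmbedding]
  congr 1
  ext a
  simp only [mem_map, mem_filter, mem_univ, true_and, Equiv.coe_toEmbedding]
  constructor
  · rintro ⟨b, hb, rfl⟩; exact hb
  · intro ha; exact ⟨σ.symm a, by simpa using ha, by simp⟩

lemma MEI_perm {m M : ℕ} (hM : 1 ≤ M) (y : Fin m → Fin M → ℝ) (σ : Equiv.Perm (Fin m))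
    (h : ∀ i l k, y i k < y l k ↔ σ i < σ l) (i : Fin m) :
    MEI y i = ((m : ℝ) - (σ i : ℕ)) / m := by
  rw [MEI_of_iff hM y i (fun l => σ i ≤ σ l)]
  · rw [card_perm σ (fun l => σ i ≤ l)]
    have : (univ.filter (fun l => σ i ≤ l)) = Finset.Ici (σ i) := by ext; simp
    rw [this, Fin.card_Ici, Nat.cast_sub (σ i).2.le]
  · intro l k
    rw [ge_iff_le, ← not_lt, ← not_lt, h]

lemma sum_pairs {m : ℕ} (F : Fin m → Fin m → ℝ) (hs : ∀ a b, F a b = F b a) :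
    ∑ h : Fin m, ∑ l : Fin m, (if h < l then F h l else 0)
      = ((∑ h : Fin m, ∑ l : Fin m, F h l) - ∑ h : Fin m, F h h) / 2 := by
  have h1 : ∑ h : Fin m, ∑ l : Fin m, F h l =
      ∑ h : Fin m, ∑ l : Fin m, (if h < l then F h l else 0)
      + ∑ h : Fin m, ∑ l : Fin m, (if l < h then F h l else 0)
      + ∑ h : Fin m, ∑ l : Fin m, (if h = l then F h h else 0) := by
    simp only [← Finset.sum_add_distrib]
    refine Finset.sum_congr rfl fun a _ => Finset.sum_congr rfl fun b _ => ?_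
    rcases lt_trichotomy a b with h | h | h
    · simp [h, h.not_gt, h.ne]
    · subst h; simp
    · simp [h, h.not_gt, h.ne']
  have h2 : ∑ h : Fin m, ∑ l : Fin m, (if l < h then F h l else 0)
      = ∑ h : Fin m, ∑ l : Fin m, (if h < l then F h l else 0) := by
    rw [Finset.sum_comm]
    refine Finset.sum_congr rfl fun a _ => Finset.sum_congr rfl fun b _ => ?_
    rw [hs]
  rw [h2] at h1
  simp at h1
  linarith

lemma MBD_perm {m M : ℕ} (hm : 2 ≤ m) (hM : 1 ≤ M) (y : Fin m → Fin M → ℝ)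
    (σ : Equiv.Perm (Fin m))
    (h : ∀ i l k, y i k < y l k ↔ σ i < σ l) (i : Fin m) :
    MBD y i = (((m : ℝ) - 1) + (σ i : ℕ) * ((m : ℝ) - 1 - (σ i : ℕ))) * (2 / (m * ((m : ℝ) - 1))) := by
  unfold MBD
  have hM' : (M : ℝ) ≠ 0 := by positivity
  set A : Fin m → ℝ := fun a => if σ a < σ i then 1 else 0 with hA
  set B : Fin m → ℝ := fun a => if σ i < σ a then 1 else 0 with hB
  have key : ∀ a b : Fin m, ((univ.filter (fun k : Fin M =>
          min (y a k) (y b k) ≤ y i k ∧ y i k ≤ max (y a k) (y b k))).card : ℝ)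
      = M * (1 - A a * A b - B a * B b) := by
    intro a b
    have e : ∀ k, (min (y a k) (y b k) ≤ y i k ∧ y i k ≤ max (y a k) (y b k)) ↔
      (¬ (σ i < σ a ∧ σ i < σ b) ∧ ¬ (σ a < σ i ∧ σ b < σ i)) := by
      intro k
      rw [← not_lt, ← not_lt, lt_min_iff, max_lt_iff]
      simp only [h]
    simp only [e, hA, hB]
    by_cases h1 : σ i < σ a <;> by_cases h2 : σ i < σ b <;> by_cases h3 : σ a < σ i <;>
      by_cases h4 : σ b < σ i <;> first | (exfalso; omega) | simp [h1, h2, h3, h4]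
  have hSA : ∑ a, A a = (σ i : ℕ) := by
    rw [hA, Finset.sum_boole, card_perm σ (fun l => l < σ i)]
    have : (univ.filter (fun l => l < σ i)) = Finset.Iio (σ i) := by ext; simp
    rw [this, Fin.card_Iio]
  have hSB : ∑ a, B a = (m : ℝ) - 1 - (σ i : ℕ) := by
    rw [hB, Finset.sum_boole, card_perm σ (fun l => σ i < l)]
    have : (univ.filter (fun l => σ i < l)) = Finset.Ioi (σ i) := by ext; simp
    rw [this, Fin.card_Ioi, Nat.cast_sub (by omega), Nat.cast_sub (by omega)]
    simp
  have hAA : ∀ a, A a * A a = A a := by intro a; simp [hA]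
  have hBB : ∀ a, B a * B a = B a := by intro a; simp [hB]
  have hall : ∑ a, ∑ b, (1 - A a * A b - B a * B b)
      = (m : ℝ) * m - (∑ a, A a) * (∑ a, A a) - (∑ a, B a) * (∑ a, B a) := by
    rw [Finset.sum_mul_sum, Finset.sum_mul_sum]
    simp [Finset.sum_sub_distrib]
  have hdg : ∑ a, (1 - A a * A a - B a * B a)
      = (m : ℝ) - (∑ a, A a) - (∑ a, B a) := by
    simp [Finset.sum_sub_distrib, hAA, hBB]
  have hsp := sum_pairs (fun a b => 1 - A a * A b - B a * B b) (fun a b => by ring)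
  rw [hall, hdg, hSA, hSB] at hsp
  have e1 : ∀ a b : Fin m, (if a < b then (M : ℝ) * (1 - A a * A b - B a * B b) else 0)
      = M * (if a < b then (1 - A a * A b - B a * B b) else 0) := by
    intro a b
    split_ifs <;> simp
  simp only [key, e1, ← Finset.mul_sum]
  rw [hsp, Nat.cast_choose_two]
  have hm2 : (2 : ℝ) ≤ m := by exact_mod_cast hm
  have h1 : (m : ℝ) - 1 ≠ 0 := by linarith
  have h0 : (m : ℝ) ≠ 0 := by linarith
  field_simp
  ring

lemma card_mid {n : ℕ} (s : Fin n) (d : ℕ) (hd : d = min (s : ℕ) (n - 1 - s)) :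
    (univ.filter (fun l : Fin n => ((s : ℕ) : ℝ) * ((n : ℝ) - 1 - (s : ℕ))
      ≤ ((l : ℕ) : ℝ) * ((n : ℝ) - 1 - (l : ℕ)))).card = n - 2 * d := by
  have hs := s.2
  have hlt : d < n := by omega
  have hlt2 : n - 1 - d < n := by omega
  have hv : ((s : ℕ) : ℝ) * ((n : ℝ) - 1 - (s : ℕ)) = (d : ℝ) * ((n : ℝ) - 1 - d) := by
    rcases le_total (s : ℕ) (n - 1 - s) with h | h
    · rw [hd, min_eq_left h]
    · rw [hd, min_eq_right h, Nat.cast_sub (by omega), Nat.cast_sub (by omega)]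
      push_cast
      ring
  have : (univ.filter (fun l : Fin n => ((s : ℕ) : ℝ) * ((n : ℝ) - 1 - (s : ℕ))
      ≤ ((l : ℕ) : ℝ) * ((n : ℝ) - 1 - (l : ℕ))))
      = Finset.Icc (⟨d, hlt⟩ : Fin n) ⟨n - 1 - d, hlt2⟩ := by
    ext l
    have hl := l.2
    simp only [mem_filter, mem_univ, true_and, Finset.mem_Icc, Fin.le_def, hv]
    have h2d : (2 * (d : ℝ)) ≤ (n : ℝ) - 1 := by
      have : 2 * d + 1 ≤ n := by omega
      have : (2 * (d : ℝ)) + 1 ≤ n := by exact_mod_cast this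
      linarith
    constructor
    · intro h
      by_contra hc
      have hc' : (l : ℕ) + 1 ≤ d ∨ n ≤ (l : ℕ) + d := by omega
      rcases hc' with hc' | hc'
      · have : ((l : ℕ) : ℝ) + 1 ≤ d := by exact_mod_cast hc'
        nlinarith
      · have : (n : ℝ) ≤ ((l : ℕ) : ℝ) + d := by exact_mod_cast hc'
        nlinarith
    · rintro ⟨h1, h2⟩
      have h1' : (d : ℝ) ≤ ((l : ℕ) : ℝ) := by exact_mod_cast h1
      have h2' : (l : ℕ) + d + 1 ≤ n := by omega
      have h2'' : ((l : ℕ) : ℝ) + d + 1 ≤ n := by exact_mod_cast h2'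
      nlinarith
  rw [this, Fin.card_Icc]
  simp only
  omega

lemma exists_rank {n : ℕ} (z : Fin n → ℝ) (hz : Function.Injective z) :
    ∃ σ : Equiv.Perm (Fin n), ∀ i l, z i < z l ↔ σ i < σ l := by
  have hm : StrictMono (z ∘ Tuple.sort z) :=
    (Tuple.monotone_sort z).strictMono_of_injective (hz.comp (Tuple.sort z).injective)
  refine ⟨(Tuple.sort z).symm, fun i l => ?_⟩
  rw [← hm.lt_iff_lt]
  simp

theorem depthgram_timewise_equality (n p N : ℕ) (hn : 2 ≤ n) (hp : 1 ≤ p) (hN : 1 ≤ N)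
    (x : Fin n → Fin p → Fin N → ℝ)
    (ha : ∀ j : Fin p, ∀ i h : Fin n, i ≠ h → ∀ k1 k2 : Fin N,
      (x i j k1 - x h j k1) * (x i j k2 - x h j k2) > 0)
    (hb : ∀ k : Fin N, ∀ i h : Fin n, i ≠ h → ∀ j l : Fin p, j ≠ l →
      (x i j k - x h j k) * (x i l k - x h l k) > 0) :
    ∀ i : Fin n,
      MBD (fun i' k => MEI (fun h => fun j => x h j k) i') i =
        gpar n (1 - MEI (fun i' k => MBD (fun h => fun j => x h j k) i') i) := by
  intro i
  let j0 : Fin p := ⟨0, hp⟩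
  let k0 : Fin N := ⟨0, hN⟩
  have hinj : Function.Injective (fun i => x i j0 k0) := by
    intro a b hab
    by_contra hne
    have := ha j0 a b hne k0 k0
    simp only at hab
    rw [hab] at this
    simp at this
  obtain ⟨σ, hσ⟩ := exists_rank _ hinj
  have sgn : ∀ u v : ℝ, u * v > 0 → (u < 0 ↔ v < 0) := by
    intro u v huv
    constructor <;> intro h <;> by_contra hc <;> nlinarith
  have hx : ∀ k, ∀ a b : Fin n, ∀ j, x a j k < x b j k ↔ σ a < σ b := by
    intro k a b j
    rw [← hσ]
    by_cases hab : a = b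
    · subst hab; simp
    have e1 := sgn _ _ (ha j a b hab k k0)
    have e2 : x a j k0 - x b j k0 < 0 ↔ x a j0 k0 - x b j0 k0 < 0 := by
      by_cases hj : j = j0
      · rw [hj]
      · exact sgn _ _ (hb k0 a b hab j j0 hj)
    rw [← sub_neg, e1, e2, sub_neg]
  have hn2 : (2 : ℝ) ≤ n := by exact_mod_cast hn
  have h1 : (0 : ℝ) < (n : ℝ) - 1 := by linarith
  have h0 : (0 : ℝ) < (n : ℝ) := by linarith
  have hu : ∀ a k, MEI (fun h => fun j => x h j k) a = ((n : ℝ) - (σ a : ℕ)) / n :=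
    fun a k => MEI_perm hp _ σ (fun i l j => hx k i l j) a
  have hv : ∀ a k, MBD (fun h => fun j => x h j k) a = _ :=
    fun a k => MBD_perm hn hp _ σ (fun i l j => hx k i l j) a
  simp only [hu, hv]
  rw [MBD_perm hn hN _ (σ.trans Fin.revPerm)]
  swap
  · intro a b k
    rw [div_lt_div_iff_of_pos_right h0]
    simp
  have hc : (0 : ℝ) < 2 / (n * ((n : ℝ) - 1)) := by positivity
  rw [MEI_of_iff hN _ i (fun l => ((σ i : ℕ) : ℝ) * ((n : ℝ) - 1 - (σ i : ℕ))
      ≤ ((σ l : ℕ) : ℝ) * ((n : ℝ) - 1 - (σ l : ℕ)))]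
  swap
  · intro l k
    simp only [ge_iff_le]
    rw [mul_le_mul_iff_left₀ hc, add_le_add_iff_left]
  rw [card_perm σ (fun l => ((σ i : ℕ) : ℝ) * ((n : ℝ) - 1 - (σ i : ℕ))
      ≤ ((l : ℕ) : ℝ) * ((n : ℝ) - 1 - (l : ℕ))), card_mid (σ i) _ rfl]
  have hs := (σ i).2
  have hrev : (((σ.trans Fin.revPerm) i : Fin n) : ℕ) = n - 1 - (σ i : ℕ) := by
    simp [Fin.val_rev]; omega
  rw [hrev]
  unfold gpar
  generalize ((σ i : Fin n) : ℕ) = s at hs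
  have ht : ((n - 1 - s : ℕ) : ℝ) = (n : ℝ) - 1 - s := by
    rw [Nat.cast_sub (by omega), Nat.cast_sub (by omega)]; simp
  have hmin : ((n - 2 * min s (n - 1 - s) : ℕ) : ℝ) = (n : ℝ) - 2 * min (s : ℝ) ((n : ℝ) - 1 - s) := by
    rw [Nat.cast_sub (by omega), Nat.cast_mul, Nat.cast_min, ht]
    norm_num
  rw [hmin, ht]
  have h1' := h1.ne'
  rcases le_total (s : ℝ) ((n : ℝ) - 1 - s) with h | h
  · rw [min_eq_left h]
    field_simp
    ring
  · rw [min_eq_right h]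
    field_simp
    ring
end

section
/- Let n ≥ 2, N ≥ 1 and let x : Fin n → Fin N → ℝ be a univariate functional sample in which no two curves cross, i.e., for all i ≠ h in Fin n and all k1, k2 ∈ Fin N, (x i k1 − x h k1)·(x i k2 − x h k2) > 0. Then for every i ∈ Fin n, MBD(x, i) = f_n(MEI(x, i)). -/
open Finset

theorem outliergram_equality_noncrossing (n N : ℕ) (hn : 2 ≤ n) (hN : 1 ≤ N)
    (x : Fin n → Fin N → ℝ)
    (hnc : ∀ i h : Fin n, i ≠ h → ∀ k1 k2 : Fin N,
      (x i k1 - x h k1) * (x i k2 - x h k2) > 0) :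
    ∀ i : Fin n, MBD x i = fpar n (MEI x i) := by
  intro i
  have k0 : Fin N := ⟨0, hN⟩
  have hge : ∀ h k, x h k ≥ x i k ↔ x h k0 ≥ x i k0 := by
    intro h k
    by_cases e : h = i
    · subst e; simp
    · have := hnc h i e k k0
      constructor
      · intro h1; by_contra h2; push Not at h2; nlinarith
      · intro h1; by_contra h2; push Not at h2; nlinarith
  have hle : ∀ h k, x h k ≤ x i k ↔ x h k0 ≤ x i k0 := by
    intro h k
    by_cases e : h = i
    · subst e; simp
    · have := hnc h i e k k0
      constructor
      · intro h1; by_contra h2; push Not at h2; nlinarith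
      · intro h1; by_contra h2; push Not at h2; nlinarith
  have hne : ∀ h, h ≠ i → x h k0 ≠ x i k0 := by
    intro h e e2
    have := hnc h i e k0 k0
    rw [e2] at this
    simp at this
  let u : Fin n → ℝ := fun h => if x h k0 ≥ x i k0 then 1 else 0
  let d : Fin n → ℝ := fun h => if h = i then 1 else 0
  let c : Fin n → Fin n → ℝ := fun h l =>
    1 - (1 - u h) * (1 - u l) - (u h - d h) * (u l - d l)
  obtain ⟨a, ha⟩ : ∃ a, a = ∑ h, u h := ⟨_, rfl⟩
  have hd : ∑ h, d h = 1 := by simp [d]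
  have h1 : ∀ h, ((univ.filter (fun k : Fin N => x h k ≥ x i k)).card : ℝ) = N * u h := by
    intro h
    simp only [hge h, u]
    by_cases e : x h k0 ≥ x i k0 <;> simp [e]
  have h2 : ∀ h l, ((univ.filter (fun k : Fin N =>
          min (x h k) (x l k) ≤ x i k ∧ x i k ≤ max (x h k) (x l k))).card : ℝ) = N * c h l := by
    intro h l
    have e : ∀ k, (min (x h k) (x l k) ≤ x i k ∧ x i k ≤ max (x h k) (x l k)) ↔
        ((x h k0 ≤ x i k0 ∨ x l k0 ≤ x i k0) ∧ (x h k0 ≥ x i k0 ∨ x l k0 ≥ x i k0)) := by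
      intro k
      rw [min_le_iff, le_max_iff, hle h k, hle l k, ← hge h k, ← hge l k]
    simp only [e, c, u, d]
    have key : ∀ h, (h = i ∧ x h k0 ≤ x i k0 ∧ x h k0 ≥ x i k0) ∨
        (h ≠ i ∧ x h k0 ≤ x i k0 ∧ ¬ x h k0 ≥ x i k0) ∨
        (h ≠ i ∧ ¬ x h k0 ≤ x i k0 ∧ x h k0 ≥ x i k0) := by
      intro h
      by_cases e : h = i
      · subst e; simp
      · rcases lt_or_gt_of_ne (hne h e) with g | g
        · right; left; exact ⟨e, g.le, not_le.mpr g⟩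
        · right; right; exact ⟨e, not_le.mpr g, g.le⟩
    rcases key h with ⟨p1, p2, p3⟩ | ⟨p1, p2, p3⟩ | ⟨p1, p2, p3⟩ <;>
    rcases key l with ⟨q1, q2, q3⟩ | ⟨q1, q2, q3⟩ | ⟨q1, q2, q3⟩ <;>
    simp only [p1, p2, p3, q1, q2, q3] <;> simp
  have hcsymm : ∀ h l, c h l = c l h := by intro h l; simp only [c]; ring
  have hcd : ∀ h, c h h = d h := by
    intro h
    simp only [c, u, d]
    by_cases e : h = i
    · subst e; simp
    · by_cases g : x h k0 ≥ x i k0 <;> simp [e, g]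
  have hall : ∑ h, ∑ l, c h l = (n : ℝ) ^ 2 - (n - a) ^ 2 - (a - 1) ^ 2 := by
    simp only [c, sum_sub_distrib, ← mul_sum, ← sum_mul, hd, ← ha]
    simp
    ring
  have hsplit : ∑ h, ∑ l, c h l = 2 * (∑ h, ∑ l, if h < l then c h l else 0) + 1 := by
    have e1 : ∀ h l, c h l = (if h < l then c h l else 0) + (if l < h then c l h else 0)
        + (if h = l then d h else 0) := by
      intro h l
      rcases lt_trichotomy h l with g | g | g
      · simp [g, g.not_gt, g.ne]
      · subst g; simp [hcd]
      · simp [g, g.not_gt, g.ne', hcsymm h l]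
    rw [sum_congr rfl (fun h _ => sum_congr rfl (fun l _ => e1 h l))]
    simp only [sum_add_distrib]
    rw [sum_comm (f := fun h l => if l < h then c l h else 0)]
    simp only [sum_ite_eq, mem_univ, if_true, hd]
    ring
  have hn0 : (n : ℝ) ≠ 0 := by positivity
  have hN0 : (N : ℝ) ≠ 0 := by positivity
  have hn1 : (n : ℝ) - 1 ≠ 0 := by
    have : (2 : ℝ) ≤ n := by exact_mod_cast hn
    linarith
  have hMEI : MEI x i = a / n := by
    unfold MEI
    simp only [h1, ← mul_sum, ← ha]
    field_simp
  have hMBD : MBD x i = 2 / (n * (n - 1)) * (∑ h, ∑ l, if h < l then c h l else 0) := by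
    unfold MBD
    simp only [h2]
    have : ∀ h l, (if h < l then (N : ℝ) * c h l else 0) = N * (if h < l then c h l else 0) := by
      intro h l; split_ifs <;> simp
    simp only [this, ← mul_sum, Nat.cast_choose_two]
    field_simp
  rw [hMBD, hMEI, show (∑ h, ∑ l, if h < l then c h l else 0) = n * a - a ^ 2 + a - 1 by
    linarith]
  unfold fpar
  field_simp
  ring
end

section
/- Let n ≥ 2, N ≥ 1 and let x : Fin n → Fin N → ℝ be a univariate functional sample in which no two curves cross, i.e., for all i ≠ h in Fin n and all k1, k2 ∈ Fin N, (x i k1 − x h k1)·(x i k2 − x h k2) > 0. Then for every i ∈ Fin n and every time point k0 ∈ Fin N, MEI(x, i) = (1 + |{h ∈ Fin n : x h k0 > x i k0}|)/n; in particular MEI(x, i) does not depend on the choice of k0. -/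
open Finset

theorem mei_noncrossing_rank (n N : ℕ) (hn : 2 ≤ n) (hN : 1 ≤ N)
    (x : Fin n → Fin N → ℝ)
    (hnc : ∀ i h : Fin n, i ≠ h → ∀ k1 k2 : Fin N,
      (x i k1 - x h k1) * (x i k2 - x h k2) > 0) :
    ∀ i : Fin n, ∀ k0 : Fin N,
      MEI x i =
        (1 + ((univ.filter (fun h : Fin n => x h k0 > x i k0)).card : ℝ)) / (n : ℝ) := by
  intro i k0
  have key : ∀ h : Fin n, ((univ.filter (fun k : Fin N => x h k ≥ x i k)).card : ℝ)
      = (N : ℝ) * ((if h = i then 1 else 0) + (if x h k0 > x i k0 then 1 else 0)) := by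
    intro h
    by_cases hi : h = i
    · subst hi
      simp
    · by_cases hk : x h k0 > x i k0
      · have : univ.filter (fun k : Fin N => x h k ≥ x i k) = univ := by
          apply Finset.filter_true_of_mem
          intro k _
          have h1 := hnc h i hi k0 k
          have h2 := (pos_iff_pos_of_mul_pos h1).1 (sub_pos.2 hk)
          linarith
        rw [this]
        simp [hi, hk]
      · have : univ.filter (fun k : Fin N => x h k ≥ x i k) = ∅ := by
          apply Finset.filter_false_of_mem
          intro k _ hge
          have h1 := hnc h i hi k0 k
          nlinarith [mul_nonneg (sub_nonneg.2 (not_lt.1 hk)) (sub_nonneg.2 hge)]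
        rw [this]
        simp [hi, hk]
  unfold MEI
  rw [Finset.sum_congr rfl (fun h _ => key h), ← Finset.mul_sum, Finset.sum_add_distrib,
    Finset.sum_ite_eq' univ i, Finset.sum_boole, if_pos (Finset.mem_univ i)]
  have hn0 : (n : ℝ) ≠ 0 := by
    have : n ≠ 0 := by omega
    exact_mod_cast this
  have hN0 : (N : ℝ) ≠ 0 := by
    have : N ≠ 0 := by omega
    exact_mod_cast this
  field_simp
end

section
/- Let n ≥ 2, N ≥ 1 and let x : Fin n → Fin N → ℝ be a univariate functional sample in which no two curves cross, i.e., for all i ≠ h in Fin n and all k1, k2 ∈ Fin N, (x i k1 − x h k1)·(x i k2 − x h k2) > 0. Fix any time point k0 ∈ Fin N and for each i ∈ Fin n let r i = |{h ∈ Fin n : x h k0 > x i k0}|. Then for every i ∈ Fin n, MBD(x, i) = 2·(r i·(n − 1 − r i) + (n − 1))/(n·(n − 1)). -/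
open Finset

theorem mbd_noncrossing_rank (n N : ℕ) (hn : 2 ≤ n) (hN : 1 ≤ N)
    (x : Fin n → Fin N → ℝ)
    (hnc : ∀ i h : Fin n, i ≠ h → ∀ k1 k2 : Fin N,
      (x i k1 - x h k1) * (x i k2 - x h k2) > 0)
    (k0 : Fin N) (r : Fin n → ℕ)
    (hr : ∀ i : Fin n, r i = (univ.filter (fun h : Fin n => x h k0 > x i k0)).card) :
    ∀ i : Fin n,
      MBD x i =
        2 * ((r i : ℝ) * ((n : ℝ) - 1 - (r i : ℝ)) + ((n : ℝ) - 1)) /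
          ((n : ℝ) * ((n : ℝ) - 1)) := by
  intro i
  have hlt : ∀ a b : Fin n, ∀ k : Fin N, x a k < x b k ↔ x a k0 < x b k0 := by
    intro a b k
    by_cases hab : a = b
    · subst hab; simp
    · have h1 := hnc a b hab k k0
      constructor
      · intro h; by_contra h2; push Not at h2; nlinarith
      · intro h; by_contra h2; push Not at h2; nlinarith
  have hle : ∀ a b : Fin n, ∀ k : Fin N, x a k ≤ x b k ↔ x a k0 ≤ x b k0 := by
    intro a b k
    rw [← not_lt, ← not_lt, hlt]
  have hne : ∀ a b : Fin n, x a k0 = x b k0 → a = b := by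
    intro a b h
    by_contra hab
    have h1 := hnc a b hab k0 k0
    rw [h] at h1; simp at h1
  let A : Fin n → ℝ := fun h => if x h k0 > x i k0 then 1 else 0
  let B : Fin n → ℝ := fun h => if x h k0 < x i k0 then 1 else 0
  let E : Fin n → ℝ := fun h => if h = i then 1 else 0
  let c : Fin n → Fin n → ℝ := fun h l => A h * B l + B h * A l + E h + E l
  have hA : ∑ h, A h = (r i : ℝ) := by
    simp [A, hr]
  have hE : ∑ h, E h = 1 := by
    simp [E]
  have hABE : ∀ h, A h + B h + E h = 1 := by
    intro h
    simp only [A, B, E]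
    by_cases hi : h = i
    · subst hi; simp
    · rcases lt_trichotomy (x h k0) (x i k0) with h1 | h1 | h1
      · simp [h1, hi, h1.le, not_lt.2 h1.le]
      · exact absurd (hne _ _ h1) hi
      · simp [h1, hi, not_lt.2 h1.le]
  have hB : ∑ h, B h = (n : ℝ) - 1 - r i := by
    have : ∑ h, (A h + B h + E h) = (n : ℝ) := by simp [hABE]
    rw [sum_add_distrib, sum_add_distrib, hA, hE] at this
    linarith
  have hterm : ∀ h l : Fin n, (if h < l then
        ((univ.filter (fun k : Fin N =>
          min (x h k) (x l k) ≤ x i k ∧ x i k ≤ max (x h k) (x l k))).card : ℝ)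
      else 0) = N * (if h < l then c h l else 0) := by
    intro h l
    split_ifs with hl
    · simp only [min_le_iff, le_max_iff, hle h i, hle l i, hle i h, hle i l]
      have hl' := hl.ne
      rw [filter_const]
      simp only [c, A, B, E]
      by_cases hi : h = i
      · subst hi
        simp [hl'.symm]
      · by_cases li : l = i
        · subst li
          simp [hi]
        · have e1 : x h k0 ≠ x i k0 := fun e => hi (hne _ _ e)
          have e2 : x l k0 ≠ x i k0 := fun e => li (hne _ _ e)
          rcases lt_or_gt_of_ne e1 with a | a <;> rcases lt_or_gt_of_ne e2 with b | b <;>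
            simp [hi, li, a, b, a.le, b.le, not_lt.2 a.le, not_lt.2 b.le, not_le.2 a, not_le.2 b]
    · simp
  have hfs : ∀ h l : Fin n, (if h < l then c h l else 0) + (if l < h then c l h else 0)
      = c h l - (if h = l then 2 * E h else 0) := by
    intro h l
    rcases lt_trichotomy h l with a | a | a
    · simp [a, a.ne, not_lt.2 a.le]
    · subst a
      simp only [lt_irrefl, if_false, if_true, c, A, B]
      rcases lt_trichotomy (x h k0) (x i k0) with h1 | h1 | h1
      · simp [h1, not_lt.2 h1.le]; ring
      · simp [h1]; ring
      · simp [h1, not_lt.2 h1.le]; ring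
    · simp only [a, a.ne', not_lt.2 a.le, if_true, if_false, c]; ring
  have hc : ∑ h, ∑ l, c h l = 2 * ((r i : ℝ) * (n - 1 - r i)) + 2 * n := by
    simp only [c, sum_add_distrib, ← mul_sum, ← sum_mul, hA, hB, hE]
    simp only [sum_const, card_univ, Fintype.card_fin, nsmul_eq_mul, ← mul_sum, hE]
    ring
  have hS : ∑ h : Fin n, ∑ l : Fin n, (if h < l then c h l else 0)
      = (r i : ℝ) * (n - 1 - r i) + (n - 1) := by
    have h1 : ∑ h : Fin n, ∑ l : Fin n, (if h < l then c h l else 0)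
        = ∑ h : Fin n, ∑ l : Fin n, (if l < h then c l h else 0) := sum_comm
    have h2 : ∑ h : Fin n, ∑ l : Fin n, ((if h < l then c h l else 0)
        + (if l < h then c l h else 0)) = 2 * ((r i : ℝ) * (n - 1 - r i)) + 2 * n - 2 := by
      simp only [hfs, sum_sub_distrib, hc, sum_ite_eq, mem_univ, if_true, ← mul_sum, hE]
      ring
    simp only [sum_add_distrib] at h2
    linarith
  unfold MBD
  simp only [hterm, ← mul_sum]
  rw [hS, Nat.cast_choose_two]
  have hn' : (2 : ℝ) ≤ n := by exact_mod_cast hn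
  have hN' : (1 : ℝ) ≤ N := by exact_mod_cast hN
  have h1 : (n : ℝ) ≠ 0 := by linarith
  have h2 : (n : ℝ) - 1 ≠ 0 := by linarith
  have h3 : (N : ℝ) ≠ 0 := by linarith
  field_simp
end

section
/- Let n ≥ 2, p ≥ 1, N ≥ 1 and let x : Fin n → Fin p → Fin N → ℝ be a multivariate functional sample satisfying both assumption (a) and assumption (b). Then the rows of the dimension-wise depth matrices are constant: for every i ∈ Fin n and all j1, j2 ∈ Fin p, u i j1 = u i j2 and v i j1 = v i j2. -/
open Finset

theorem depth_rows_constant (n p N : ℕ) (hn : 2 ≤ n) (hp : 1 ≤ p) (hN : 1 ≤ N)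
    (x : Fin n → Fin p → Fin N → ℝ)
    (ha : ∀ j : Fin p, ∀ i h : Fin n, i ≠ h → ∀ k1 k2 : Fin N,
      (x i j k1 - x h j k1) * (x i j k2 - x h j k2) > 0)
    (hb : ∀ k : Fin N, ∀ i h : Fin n, i ≠ h → ∀ j l : Fin p, j ≠ l →
      (x i j k - x h j k) * (x i l k - x h l k) > 0) :
    ∀ i : Fin n, ∀ j1 j2 : Fin p,
      MEI (fun h => x h j1) i = MEI (fun h => x h j2) i ∧
      MBD (fun h => x h j1) i = MBD (fun h => x h j2) i := by
  intro i j1 j2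
  have key : ∀ (a b : Fin n) (k : Fin N), x a j1 k ≤ x b j1 k ↔ x a j2 k ≤ x b j2 k := by
    intro a b k
    by_cases hab : a = b
    · subst hab; simp
    by_cases hj : j1 = j2
    · subst hj; rfl
    have h := hb k a b hab j1 j2 hj
    rcases pos_and_pos_or_neg_and_neg_of_mul_pos h with ⟨h1, h2⟩ | ⟨h1, h2⟩
    · constructor <;> intro h3 <;> linarith
    · constructor <;> intro h3 <;> linarith
  constructor
  · simp only [MEI, ge_iff_le, key]
  · simp only [MBD, min_le_iff, le_max_iff, key]
end

section
/- Let n ≥ 2 be an integer and let σ : Fin n → Fin n be a bijection; for i ∈ Fin n write s i = (σ i).val + 1 ∈ {1, …, n}. Then for every i ∈ Fin n, |{h ∈ Fin n : f_n((s h)/n) ≥ f_n((s i)/n)}| = 1 + |n + 1 − 2·(s i)|. -/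
open Finset

theorem fpar_ge_iff_aux (n : ℕ) (hn : 2 ≤ n) (a b : ℕ) (ha : a < n) (hb : b < n) :
    fpar n (((a + 1 : ℕ) : ℝ) / (n : ℝ)) ≥ fpar n (((b + 1 : ℕ) : ℝ) / (n : ℝ)) ↔
      a ∈ Finset.Icc (min b (n - 1 - b)) (max b (n - 1 - b)) := by
  have hn' : (2 : ℝ) ≤ n := by exact_mod_cast hn
  have h0 : (n : ℝ) ≠ 0 := by linarith
  have h1 : (n : ℝ) - 1 ≠ 0 := by linarith
  have hpos : (0 : ℝ) < 2 / ((n : ℝ) * ((n : ℝ) - 1)) := by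
    apply div_pos two_pos
    apply mul_pos <;> linarith
  have key : fpar n (((a + 1 : ℕ) : ℝ) / (n : ℝ)) - fpar n (((b + 1 : ℕ) : ℝ) / (n : ℝ)) =
      2 / ((n : ℝ) * ((n : ℝ) - 1)) * ((((a : ℤ) - b) * ((n : ℤ) - 1 - a - b) : ℤ) : ℝ) := by
    unfold fpar
    push_cast
    field_simp
    ring
  rw [ge_iff_le, ← sub_nonneg, key, mul_nonneg_iff_of_pos_left hpos, Int.cast_nonneg_iff,
    mul_nonneg_iff, Finset.mem_Icc]
  omega

theorem fpar_rank_count (n : ℕ) (hn : 2 ≤ n) (σ : Fin n → Fin n)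
    (hσ : Function.Bijective σ) :
    ∀ i : Fin n,
      ((univ.filter (fun h : Fin n =>
          fpar n ((((σ h).val + 1 : ℕ) : ℝ) / (n : ℝ)) ≥
            fpar n ((((σ i).val + 1 : ℕ) : ℝ) / (n : ℝ)))).card : ℤ) =
        1 + |(n : ℤ) + 1 - 2 * (((σ i).val + 1 : ℕ) : ℤ)| := by
  intro i
  have hb := (σ i).isLt
  generalize hbd : (σ i).val = b at *
  have hcard : (univ.filter (fun h : Fin n =>
          fpar n ((((σ h).val + 1 : ℕ) : ℝ) / (n : ℝ)) ≥
            fpar n (((b + 1 : ℕ) : ℝ) / (n : ℝ)))).card =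
      (Finset.Icc (min b (n - 1 - b)) (max b (n - 1 - b))).card := by
    apply Finset.card_bij (fun h _ => (σ h).val)
    · intro h hh
      exact (fpar_ge_iff_aux n hn _ b (σ h).isLt hb).1 (Finset.mem_filter.1 hh).2
    · intro x _ y _ hxy
      exact hσ.1 (Fin.ext hxy)
    · intro a ha
      have han : a < n := by
        have := Finset.mem_Icc.1 ha
        omega
      obtain ⟨h, hh⟩ := hσ.2 ⟨a, han⟩
      have hv : (σ h).val = a := by rw [hh]
      refine ⟨h, Finset.mem_filter.2 ⟨Finset.mem_univ _, ?_⟩, hv⟩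
      rw [hv]
      exact (fpar_ge_iff_aux n hn a b han hb).2 ha
  rw [hcard, Nat.card_Icc]
  rcases abs_cases ((n : ℤ) + 1 - 2 * ((b + 1 : ℕ) : ℤ)) with h | h <;> omega
end

section
/- Let n ≥ 2, N ≥ 1 and let x : Fin n → Fin N → ℝ be a univariate functional sample, and let i ∈ Fin n be such that x h k ≠ x i k for all h ≠ i and all k ∈ Fin N. Then the modified epigraph index of the i-th curve in the sign-reversed sample satisfies MEI((fun h k => −(x h k)), i) = (n+1)/n − MEI(x, i). -/
open Finset

theorem mei_neg_relation (n N : ℕ) (hn : 2 ≤ n) (hN : 1 ≤ N)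
    (x : Fin n → Fin N → ℝ) (i : Fin n)
    (hne : ∀ h : Fin n, h ≠ i → ∀ k : Fin N, x h k ≠ x i k) :
    MEI (fun h k => -(x h k)) i = ((n : ℝ) + 1) / (n : ℝ) - MEI x i := by
  have hn0 : (n : ℝ) ≠ 0 := by
    have : n ≠ 0 := by omega
    exact_mod_cast this
  have hN0 : (N : ℝ) ≠ 0 := by
    have : N ≠ 0 := by omega
    exact_mod_cast this
  have key : ∀ h : Fin n,
      ((univ.filter (fun k : Fin N => -(x h k) ≥ -(x i k))).card : ℝ) +
        ((univ.filter (fun k : Fin N => x h k ≥ x i k)).card : ℝ) =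
      (N : ℝ) + if h = i then (N : ℝ) else 0 := by
    intro h
    by_cases hi : h = i
    · subst hi
      simp
    · have e : (univ.filter (fun k : Fin N => -(x h k) ≥ -(x i k))) =
          univ.filter (fun k : Fin N => ¬ (x h k ≥ x i k)) := by
        apply Finset.filter_congr
        intro k _
        have := hne h hi k
        rw [ge_iff_le, neg_le_neg_iff, ge_iff_le, not_le]
        exact ⟨fun h' => lt_of_le_of_ne h' this, le_of_lt⟩
      have c := Finset.card_filter_add_card_filter_not (s := (univ : Finset (Fin N)))
        (fun k : Fin N => x h k ≥ x i k)
      rw [Finset.card_univ, Fintype.card_fin] at c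
      rw [e, if_neg hi, add_zero, add_comm]
      exact_mod_cast c
  have total := Finset.sum_congr (rfl : (univ : Finset (Fin n)) = univ) (fun h _ => key h)
  rw [Finset.sum_add_distrib, Finset.sum_add_distrib] at total
  simp only [Finset.sum_const, Finset.card_univ, Fintype.card_fin, nsmul_eq_mul,
    Finset.sum_ite_eq', Finset.mem_univ, if_true] at total
  unfold MEI
  rw [eq_sub_iff_add_eq, ← mul_add, total]
  field_simp
end
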